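/- Define K_r(f, δ) = inf over g ∈ C^r with g, g^{(r)} bounded of (‖f - g‖ + δ^r ‖g^{(r)}‖), sup norm. Then for every bounded continuous f : ℝ → ℝ, δ > 0 and r ≥ 1: ‖(I - T_δ)^r f‖ ≤ 2^r K_r(f, δ) and K_r(f, δ) ≤ 2^r (r^r + 34^r) ‖(I - T_δ)^r f‖. -/

import Mathlib

/-- Forward Steklov operator `T_δ f(x) = (1/δ) ∫₀^δ f(x+t) dt`. -/
noncomputable def steklov (δ : ℝ) (f : ℝ → ℝ) : ℝ → ℝ :=
  fun x => (1 / δ) * ∫ t in (0:ℝ)..δ, f (x + t)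

/-- The difference operator `(I - T_δ) f`. -/
noncomputable def steklovDiff (δ : ℝ) (f : ℝ → ℝ) : ℝ → ℝ :=
  fun x => f x - steklov δ f x

/-- Peetre K-functional of order `r` (sup norm), taken over Cʳ functions `g`
with `g` and `g⁽ʳ⁾` bounded. -/
noncomputable def Kr (r : ℕ) (δ : ℝ) (f : ℝ → ℝ) : ℝ :=
  sInf {c : ℝ | ∃ g : ℝ → ℝ, ContDiff ℝ (r : ℕ∞) g ∧
    BddAbove (Set.range fun x => |g x|) ∧
    BddAbove (Set.range fun x => |iteratedDeriv r g x|) ∧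
    c = (⨆ x, |f x - g x|) + δ ^ r * ⨆ x, |iteratedDeriv r g x|}

open BoundedContinuousFunction

theorem steklov_hasDerivAt {δ : ℝ} {f : ℝ → ℝ} (hf : Continuous f) (x : ℝ) :
    HasDerivAt (steklov δ f) ((f (x + δ) - f x) / δ) x := by
  have hF : ∀ y, HasDerivAt (fun u => ∫ t in (0:ℝ)..u, f t) (f y) y := fun y =>
    (hf.integral_hasStrictDerivAt 0 y).hasDerivAt
  have heq : steklov δ f =
      fun x => (1 / δ) * ((∫ t in (0:ℝ)..(x + δ), f t) - ∫ t in (0:ℝ)..x, f t) := by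
    funext y
    rw [intervalIntegral.integral_interval_sub_left (hf.intervalIntegrable _ _)
      (hf.intervalIntegrable _ _)]
    simp [steklov]
  rw [heq]
  have h := (((hF (x + δ)).comp_add_const x δ).sub (hF x)).const_mul (1 / δ)
  exact h.congr_deriv (by ring)

theorem steklov_continuous {δ : ℝ} {f : ℝ → ℝ} (hf : Continuous f) :
    Continuous (steklov δ f) :=
  continuous_iff_continuousAt.2 fun x => (steklov_hasDerivAt hf x).continuousAt

theorem abs_steklov_sub_le {δ : ℝ} (hδ : 0 < δ) {f : ℝ → ℝ} (hf : Continuous f) {x c : ℝ}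
    {b : ℝ → ℝ} (hb : Continuous b) (h : ∀ t ∈ Set.Icc 0 δ, |f (x + t) - c * t - f x| ≤ b t) :
    |steklov δ f x - c * (δ / 2) - f x| ≤ (1 / δ) * ∫ t in (0:ℝ)..δ, b t := by
  have e : steklov δ f x - c * (δ / 2) - f x =
      (1 / δ) * ∫ t in (0:ℝ)..δ, (f (x + t) - c * t - f x) := by
    have i1 : IntervalIntegrable (fun t => f (x + t)) MeasureTheory.volume 0 δ :=
      (hf.comp (by fun_prop)).intervalIntegrable _ _
    have i2 : IntervalIntegrable (fun t => c * t) MeasureTheory.volume 0 δ :=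
      (by fun_prop : Continuous fun t : ℝ => c * t).intervalIntegrable _ _
    rw [intervalIntegral.integral_sub (i1.sub i2) (by simp),
      intervalIntegral.integral_sub i1 i2, intervalIntegral.integral_const_mul, integral_id,
      intervalIntegral.integral_const, smul_eq_mul, steklov]
    field_simp
    ring
  rw [e, abs_mul, abs_of_pos (by positivity : 0 < 1 / δ)]
  gcongr
  exact intervalIntegral.norm_integral_le_of_norm_le (f := fun t => f (x + t) - c * t - f x) hδ.le
    (Filter.Eventually.of_forall fun t ht => h t ⟨ht.1.le, ht.2⟩) (hb.intervalIntegrable _ _)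

theorem abs_steklov_le {δ : ℝ} (hδ : 0 < δ) {f : ℝ → ℝ} {C : ℝ} (h : ∀ x, |f x| ≤ C) (x : ℝ) :
    |steklov δ f x| ≤ C := by
  rw [steklov, abs_mul, abs_of_pos (by positivity : 0 < 1 / δ)]
  have := intervalIntegral.norm_integral_le_of_norm_le_const (a := 0) (b := δ)
    (f := fun t => f (x + t)) (C := C) fun t _ => h _
  rw [sub_zero, abs_of_pos hδ, Real.norm_eq_abs] at this
  calc (1 / δ) * |∫ t in (0:ℝ)..δ, f (x + t)| ≤ (1 / δ) * (C * δ) := by gcongr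
    _ = C := by field_simp

theorem deriv_steklov {δ : ℝ} {f : ℝ → ℝ} (hf : ContDiff ℝ 1 f) :
    deriv (steklov δ f) = steklov δ (deriv f) := by
  funext x
  rw [(steklov_hasDerivAt hf.continuous x).deriv, steklov]
  rw [intervalIntegral.integral_comp_add_left (fun t => deriv f t),
    intervalIntegral.integral_deriv_eq_sub (fun t _ => (hf.differentiable one_ne_zero) t)
    ((hf.continuous_deriv le_rfl).intervalIntegrable _ _)]
  simp only [add_zero]
  ring

theorem steklov_contDiff_and_iteratedDeriv {δ : ℝ} (n : ℕ) {f : ℝ → ℝ} (hf : ContDiff ℝ n f) :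
    ContDiff ℝ n (steklov δ f) ∧
      iteratedDeriv n (steklov δ f) = steklov δ (iteratedDeriv n f) := by
  induction n generalizing f with
  | zero =>
    refine ⟨?_, by simp⟩
    exact contDiff_zero.2 (steklov_continuous hf.continuous)
  | succ n ih =>
    have h1 : ContDiff ℝ 1 f := hf.of_le (by norm_cast; omega)
    have hd : ContDiff ℝ n (deriv f) := by
      push_cast at hf
      exact (contDiff_succ_iff_deriv.1 hf).2.2
    refine ⟨?_, ?_⟩
    · push_cast
      refine (contDiff_succ_iff_deriv (n := n)).2
        ⟨fun x => (steklov_hasDerivAt hf.continuous x).differentiableAt, by simp, ?_⟩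
      rw [deriv_steklov h1]
      exact (ih hd).1
    · rw [iteratedDeriv_succ', deriv_steklov h1, (ih hd).2, iteratedDeriv_succ']

theorem abs_steklovDiff_iterate_le {δ : ℝ} (hδ : 0 < δ) (r : ℕ) {g : ℝ → ℝ}
    (hg : ContDiff ℝ r g) {M : ℝ} (hM : ∀ x, |iteratedDeriv r g x| ≤ M) (x : ℝ) :
    |(steklovDiff δ)^[r] g x| ≤ (δ / 2) ^ r * M := by
  induction r generalizing g M with
  | zero => simpa using hM x
  | succ r ih =>
    have hr : ContDiff ℝ r g := hg.of_le (by norm_cast; omega)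
    obtain ⟨h1, h2⟩ := steklov_contDiff_and_iteratedDeriv (δ := δ) r hr
    have hcont : Continuous (iteratedDeriv r g) := hr.continuous_iteratedDeriv' r
    rw [Function.iterate_succ_apply, pow_succ, mul_assoc]
    refine ih (hr.sub h1) fun y => ?_
    have e : iteratedDeriv r (fun x => g x - steklov δ g x) y =
        iteratedDeriv r g y - steklov δ (iteratedDeriv r g) y := by
      rw [← h2]
      exact iteratedDeriv_sub hr.contDiffAt h1.contDiffAt
    rw [e, abs_sub_comm]
    have hlip : ∀ t ∈ Set.Icc 0 δ,
        |iteratedDeriv r g (y + t) - 0 * t - iteratedDeriv r g y| ≤ M * t := by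
      intro t ht
      have hd : ∀ z ∈ Set.univ, DifferentiableAt ℝ (iteratedDeriv r g) z := fun z _ =>
        (hg.differentiable_iteratedDeriv r (by norm_cast; omega)) z
      have := convex_univ.norm_image_sub_le_of_norm_deriv_le (C := M) hd
        (fun z _ => by rw [← iteratedDeriv_succ]; exact hM z) (Set.mem_univ y)
        (Set.mem_univ (y + t))
      simpa [abs_of_nonneg ht.1] using this
    have := abs_steklov_sub_le hδ hcont (by fun_prop : Continuous fun t => M * t) hlip
    rw [intervalIntegral.integral_const_mul, integral_id] at this
    refine (le_of_eq (by ring_nf)).trans (this.trans (le_of_eq ?_))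
    field_simp
    ring

/-- The Steklov operator on bounded continuous functions. -/
noncomputable def steklovCLM {δ : ℝ} (hδ : 0 < δ) : (ℝ →ᵇ ℝ) →L[ℝ] (ℝ →ᵇ ℝ) :=
  LinearMap.mkContinuous
    { toFun := fun f => ofNormedAddCommGroup (steklov δ f) (steklov_continuous f.continuous) ‖f‖
        (abs_steklov_le hδ f.norm_coe_le_norm)
      map_add' := fun f g => by
        ext x
        have hi : ∀ h : ℝ →ᵇ ℝ,
            IntervalIntegrable (fun t => h (x + t)) MeasureTheory.volume 0 δ := fun h =>
          (h.continuous.comp (by fun_prop)).intervalIntegrable _ _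
        simp only [coe_ofNormedAddCommGroup, steklov, BoundedContinuousFunction.coe_add,
          Pi.add_apply]
        rw [intervalIntegral.integral_add (hi f) (hi g), mul_add]
      map_smul' := fun c f => by
        ext x
        simp [steklov]
        ring }
    1 fun f => by
      rw [one_mul]
      exact norm_ofNormedAddCommGroup_le _ (norm_nonneg f) (abs_steklov_le hδ f.norm_coe_le_norm)

theorem steklovCLM_apply {δ : ℝ} (hδ : 0 < δ) (f : ℝ →ᵇ ℝ) (x : ℝ) :
    steklovCLM hδ f x = steklov δ f x := rfl

theorem norm_steklovCLM_le {δ : ℝ} (hδ : 0 < δ) : ‖steklovCLM hδ‖ ≤ 1 :=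
  LinearMap.mkContinuous_norm_le _ zero_le_one _

/-- The forward difference operator with step `δ` on bounded continuous functions. -/
noncomputable def forwardDiffCLM (δ : ℝ) : (ℝ →ᵇ ℝ) →L[ℝ] (ℝ →ᵇ ℝ) :=
  LinearMap.mkContinuous
    { toFun := fun f => f.compContinuous ⟨fun x => x + δ, by fun_prop⟩ - f
      map_add' := fun f g => by
        ext x
        simp
        ring
      map_smul' := fun c f => by
        ext x
        simp
        ring }
    2 fun f => by
      refine (norm_sub_le _ _).trans ?_
      rw [two_mul]
      gcongr
      exact norm_compContinuous_le f _

theorem forwardDiffCLM_apply (δ : ℝ) (f : ℝ →ᵇ ℝ) (x : ℝ) :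
    forwardDiffCLM δ f x = f (x + δ) - f x := rfl

theorem norm_forwardDiffCLM_le (δ : ℝ) : ‖forwardDiffCLM δ‖ ≤ 2 :=
  LinearMap.mkContinuous_norm_le _ zero_le_two _

theorem commute_forwardDiffCLM_steklovCLM {δ : ℝ} (hδ : 0 < δ) :
    Commute (forwardDiffCLM δ) (steklovCLM hδ) := by
  ext f x
  have hi : ∀ y, IntervalIntegrable (fun t => f (y + t)) MeasureTheory.volume 0 δ := fun y =>
    (f.continuous.comp (by fun_prop)).intervalIntegrable _ _
  have hi' : IntervalIntegrable (fun t => f (x + t + δ)) MeasureTheory.volume 0 δ :=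
    (f.continuous.comp (by fun_prop)).intervalIntegrable _ _
  simp only [mul_apply_eq_comp, forwardDiffCLM_apply, steklovCLM_apply, steklov]
  rw [intervalIntegral.integral_sub hi' (hi x), mul_sub]
  simp only [add_right_comm]

theorem steklovCLM_hasDerivAt {δ : ℝ} (hδ : 0 < δ) (f : ℝ →ᵇ ℝ) (x : ℝ) :
    HasDerivAt (steklovCLM hδ f) (forwardDiffCLM δ f x / δ) x :=
  steklov_hasDerivAt f.continuous x

theorem coe_one_sub_steklovCLM_pow {δ : ℝ} (hδ : 0 < δ) (r : ℕ) (f : ℝ →ᵇ ℝ) :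
    (((1 - steklovCLM hδ) ^ r) f : ℝ → ℝ) = (steklovDiff δ)^[r] f := by
  induction r with
  | zero => rfl
  | succ r ih =>
    rw [Function.iterate_succ_apply', ← ih, pow_succ']
    rfl

theorem steklovCLM_pow_contDiff_and_iteratedDeriv {δ : ℝ} (hδ : 0 < δ) (r : ℕ) (f : ℝ →ᵇ ℝ) :
    ContDiff ℝ r ((steklovCLM hδ ^ r) f) ∧
      ∀ x, iteratedDeriv r ((steklovCLM hδ ^ r) f) x = (forwardDiffCLM δ ^ r) f x / δ ^ r := by
  induction r generalizing f with
  | zero =>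
    refine ⟨?_, by simp⟩
    exact contDiff_zero.2 f.continuous
  | succ r ih =>
    have hd : deriv ((steklovCLM hδ ^ (r + 1)) f) =
        (steklovCLM hδ ^ r) (δ⁻¹ • forwardDiffCLM δ f) := by
      funext x
      rw [pow_succ', mul_apply_eq_comp, (steklovCLM_hasDerivAt hδ _ x).deriv,
        ← mul_apply_eq_comp,
        ((commute_forwardDiffCLM_steklovCLM hδ).pow_right r).eq, map_smul,
        mul_apply_eq_comp]
      simp [div_eq_inv_mul]
    refine ⟨?_, fun x => ?_⟩
    · rw [Nat.cast_add, Nat.cast_one]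
      refine (contDiff_succ_iff_deriv (n := r)).2 ⟨?_, by simp, ?_⟩
      · rw [pow_succ', mul_apply_eq_comp]
        exact fun x => (steklovCLM_hasDerivAt hδ _ x).differentiableAt
      · rw [hd]
        exact (ih _).1
    · rw [iteratedDeriv_succ', hd, (ih _).2, map_smul, pow_succ (forwardDiffCLM δ),
        mul_apply_eq_comp]
      simp only [BoundedContinuousFunction.coe_smul, smul_eq_mul]
      field_simp
      ring

/-- The one-step inverse estimate: the Taylor expansion of `T² f` together with
`‖Δ f‖ ≤ ‖Δ T f‖ + 2 ‖f - T f‖`. -/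
theorem norm_forwardDiffCLM_steklovCLM_le {δ : ℝ} (hδ : 0 < δ) (f : ℝ →ᵇ ℝ) :
    ‖forwardDiffCLM δ (steklovCLM hδ f)‖ ≤ 10 * ‖(1 - steklovCLM hδ) f‖ := by
  set T := steklovCLM hδ
  set ε := ‖(1 - T) f‖
  set v := forwardDiffCLM δ (T f) with hv
  set K := ‖forwardDiffCLM δ f‖ with hKdef
  have hK : K ≤ ‖v‖ + 2 * ε := by
    have e : forwardDiffCLM δ f = v + forwardDiffCLM δ ((1 - T) f) := by
      rw [hv, ← map_add]
      congr 1
      simp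
    rw [hKdef, e]
    exact (norm_add_le _ _).trans
      (by gcongr; exact (forwardDiffCLM δ).le_of_opNorm_le (norm_forwardDiffCLM_le δ) _)
  have hε : ‖(1 - T) (T (T f))‖ ≤ ε := by
    have e : (1 - T) (T (T f)) = T (T ((1 - T) f)) := by simp
    rw [e]
    have h1 : ∀ h, ‖T h‖ ≤ ‖h‖ := fun h => by
      simpa using T.le_of_opNorm_le (norm_steklovCLM_le hδ) h
    exact (h1 _).trans (h1 _)
  have hlip : ∀ y t : ℝ, 0 ≤ t → |T f (y + t) - T f y| ≤ K / δ * t := by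
    intro y t ht
    have := convex_univ.norm_image_sub_le_of_norm_hasDerivWithin_le (C := K / δ)
      (fun z _ => (steklovCLM_hasDerivAt hδ f z).hasDerivWithinAt)
      (fun z _ => by
        rw [norm_div, Real.norm_of_nonneg hδ.le]
        gcongr
        exact (forwardDiffCLM δ f).norm_coe_le_norm z) (Set.mem_univ y)
      (Set.mem_univ (y + t))
    simpa [abs_of_nonneg ht] using this
  have hvlip : ∀ y t : ℝ, 0 ≤ t → |v (y + t) - v y| ≤ 2 * (K / δ) * t := by
    intro y t ht
    have e : v (y + t) - v y =
        (T f (y + δ + t) - T f (y + δ)) - (T f (y + t) - T f y) := by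
      simp only [hv, forwardDiffCLM_apply, add_right_comm y t δ]
      ring
    rw [e]
    have := (abs_sub _ _).trans (add_le_add (hlip (y + δ) t ht) (hlip y t ht))
    linarith
  have hpt : ∀ x, |v x| ≤ 2 * (ε + K / 3) := by
    intro x
    have taylor : ∀ t ∈ Set.Icc 0 δ,
        |T (T f) (x + t) - v x / δ * t - T (T f) x| ≤ K / δ ^ 2 * t ^ 2 := by
      have hd : ∀ t, HasDerivAt (fun t => T (T f) (x + t) - v x / δ * t - T (T f) x)
          ((v (x + t) - v x) / δ) t := by
        intro t
        have := (((steklovCLM_hasDerivAt hδ (T f) (x + t)).comp_const_add x t).sub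
          ((hasDerivAt_id t).const_mul (v x / δ))).sub_const (T (T f) x)
        exact this.congr_deriv (by rw [mul_one, sub_div])
      have hB : ∀ t, HasDerivAt (fun t => K / δ ^ 2 * t ^ 2) (2 * K / δ ^ 2 * t) t := by
        intro t
        have := (hasDerivAt_pow 2 t).const_mul (K / δ ^ 2)
        exact this.congr_deriv (by simp only [Nat.cast_ofNat]; ring)
      intro t ht
      refine image_norm_le_of_norm_deriv_right_le_deriv_boundary
        (fun t _ => (hd t).continuousAt.continuousWithinAt)
        (fun t _ => (hd t).hasDerivWithinAt) (by simp) hB (fun t ht => ?_) ht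
      rw [norm_div, Real.norm_of_nonneg hδ.le, div_le_iff₀ hδ]
      refine (hvlip x t ht.1).trans (le_of_eq ?_)
      field_simp
    have h1 := abs_steklov_sub_le hδ (T (T f)).continuous
      (by fun_prop : Continuous fun t => K / δ ^ 2 * t ^ 2) taylor
    have h2 : |T (T f) x - steklov δ (T (T f)) x| ≤ ε :=
      (((1 - T) (T (T f))).norm_coe_le_norm x).trans hε
    have e1 : v x / δ * (δ / 2) = v x / 2 := by field_simp
    have e2 : (1 / δ) * ∫ t in (0:ℝ)..δ, K / δ ^ 2 * t ^ 2 = K / 3 := by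
      rw [intervalIntegral.integral_const_mul, integral_pow]
      field_simp
      ring
    rw [e1, e2] at h1
    rw [abs_le] at h1 h2 ⊢
    constructor <;> linarith [h1.1, h1.2, h2.1, h2.2]
  have hn : ‖v‖ ≤ 2 * (ε + K / 3) :=
    (norm_le (by positivity)).2 hpt
  linarith

theorem commute_one_sub_right {E : Type*} [NormedAddCommGroup E] [NormedSpace ℝ E]
    {A B : E →L[ℝ] E} (h : Commute A B) : Commute A (1 - B) :=
  Commute.sub_right (Commute.one_right A) h

theorem norm_forwardDiffCLM_mul_steklovCLM_pow_le {δ : ℝ} (hδ : 0 < δ) (r : ℕ) (f : ℝ →ᵇ ℝ) :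
    ‖((forwardDiffCLM δ * steklovCLM hδ) ^ r) f‖ ≤ 10 ^ r * ‖((1 - steklovCLM hδ) ^ r) f‖ := by
  induction r generalizing f with
  | zero => simp
  | succ r ih =>
    have hc : Commute (1 - steklovCLM hδ) ((forwardDiffCLM δ * steklovCLM hδ) ^ r) :=
      ((commute_one_sub_right
        ((commute_forwardDiffCLM_steklovCLM hδ).mul_left (Commute.refl _))).symm).pow_right r
    calc _ ≤ 10 * ‖(1 - steklovCLM hδ) (((forwardDiffCLM δ * steklovCLM hδ) ^ r) f)‖ := by
          rw [pow_succ']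
          exact norm_forwardDiffCLM_steklovCLM_le hδ _
      _ = 10 * ‖((forwardDiffCLM δ * steklovCLM hδ) ^ r) ((1 - steklovCLM hδ) f)‖ := by
          rw [← mul_apply_eq_comp, hc.eq, mul_apply_eq_comp]
      _ ≤ 10 * (10 ^ r * ‖((1 - steklovCLM hδ) ^ r) ((1 - steklovCLM hδ) f)‖) := by
          gcongr
          exact ih _
      _ = _ := by
          rw [← mul_apply_eq_comp, ← pow_succ]
          ring

theorem norm_pow_le_one {E : Type*} [NormedAddCommGroup E] [NormedSpace ℝ E]
    {T : E →L[ℝ] E} (hT : ‖T‖ ≤ 1) (i : ℕ) : ‖T ^ i‖ ≤ 1 := by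
  induction i with
  | zero => exact ContinuousLinearMap.norm_id_le
  | succ i ih =>
    rw [pow_succ']
    exact (ContinuousLinearMap.opNorm_comp_le T (T ^ i)).trans
      (mul_le_one₀ hT (norm_nonneg _) ih)

/-- For a contraction `T`, the power `(1 - Tᵐ)ʳ` is controlled by `(1 - T)ʳ`. -/
theorem norm_one_sub_pow_pow_apply_le {E : Type*} [NormedAddCommGroup E] [NormedSpace ℝ E]
    {T : E →L[ℝ] E} (hT : ‖T‖ ≤ 1) (m r : ℕ) (f : E) :
    ‖((1 - T ^ m) ^ r) f‖ ≤ (m : ℝ) ^ r * ‖((1 - T) ^ r) f‖ := by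
  have hTf : ∀ i : ℕ, ‖T ^ i‖ ≤ 1 := norm_pow_le_one hT
  have hA : ‖∑ i ∈ Finset.range m, T ^ i‖ ≤ m := by
    simpa using norm_sum_le_of_le (Finset.range m) fun i _ => hTf i
  have hc : Commute (∑ i ∈ Finset.range m, T ^ i) (1 - T) :=
    commute_one_sub_right
      (Commute.sum_left _ _ _ fun i _ => (Commute.refl T).pow_left i)
  have hpow : ∀ (k : ℕ) (h : E), ‖((∑ i ∈ Finset.range m, T ^ i) ^ k) h‖ ≤ (m : ℝ) ^ k * ‖h‖ := by
    intro k h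
    induction k with
    | zero => simp
    | succ k ih =>
      rw [pow_succ', pow_succ', mul_assoc]
      exact (ContinuousLinearMap.le_of_opNorm_le _ hA _).trans
        (mul_le_mul_of_nonneg_left ih (Nat.cast_nonneg m))
  rw [← geom_sum_mul_neg, hc.mul_pow]
  exact hpow r _

theorem norm_one_sub_pow_apply_le {E : Type*} [NormedAddCommGroup E] [NormedSpace ℝ E]
    {U : E →L[ℝ] E} (hU : ‖U‖ ≤ 1) (i : ℕ) (h : E) : ‖((1 - U) ^ i) h‖ ≤ 2 ^ i * ‖h‖ := by
  induction i with
  | zero => simp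
  | succ i ih =>
    rw [pow_succ', pow_succ', mul_assoc]
    have h1 := U.le_of_opNorm_le hU (((1 - U) ^ i) h)
    have h2 := norm_sub_le (((1 - U) ^ i) h) (U (((1 - U) ^ i) h))
    change ‖((1 - U) ^ i) h - U (((1 - U) ^ i) h)‖ ≤ _
    linarith

theorem norm_sum_one_sub_pow_apply_le {E : Type*} [NormedAddCommGroup E] [NormedSpace ℝ E]
    {U : E →L[ℝ] E} (hU : ‖U‖ ≤ 1) (r : ℕ) (h : E) :
    ‖(∑ i ∈ Finset.range r, (1 - U) ^ i) h‖ ≤ 2 ^ r * ‖h‖ := by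
  rw [_root_.sum_apply]
  refine (norm_sum_le_of_le _ fun i _ => norm_one_sub_pow_apply_le hU i h).trans ?_
  rw [← Finset.sum_mul]
  gcongr
  have := geom_sum_mul (2 : ℝ) r
  linarith

theorem norm_eq_iSup_abs (f : ℝ →ᵇ ℝ) : ‖f‖ = ⨆ x, |f x| :=
  f.norm_eq_iSup_norm

theorem bddAbove_range_abs (f : ℝ →ᵇ ℝ) : BddAbove (Set.range fun x => |f x|) :=
  ⟨‖f‖, by rintro _ ⟨x, rfl⟩; exact f.norm_coe_le_norm x⟩

theorem exists_coe_eq {f : ℝ → ℝ} (hf : Continuous f)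
    (hb : BddAbove (Set.range fun x => |f x|)) : ∃ F : ℝ →ᵇ ℝ, (F : ℝ → ℝ) = f :=
  let ⟨C, hC⟩ := hb
  ⟨ofNormedAddCommGroup f hf C fun x => hC ⟨x, rfl⟩, rfl⟩

theorem Kr_le {r : ℕ} {δ : ℝ} (hδ : 0 < δ) {f g : ℝ → ℝ} (hg : ContDiff ℝ r g)
    (hb : BddAbove (Set.range fun x => |g x|))
    (hd : BddAbove (Set.range fun x => |iteratedDeriv r g x|)) :
    Kr r δ f ≤ (⨆ x, |f x - g x|) + δ ^ r * ⨆ x, |iteratedDeriv r g x| := by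
  refine csInf_le ⟨0, ?_⟩ ⟨g, hg, hb, hd, rfl⟩
  rintro _ ⟨g, -, -, -, rfl⟩
  have h1 : 0 ≤ ⨆ x, |f x - g x| := Real.iSup_nonneg fun x => abs_nonneg _
  have h2 : 0 ≤ ⨆ x, |iteratedDeriv r g x| := Real.iSup_nonneg fun x => abs_nonneg _
  positivity

theorem le_Kr {r : ℕ} {δ : ℝ} (hδ : 0 < δ) (F : ℝ →ᵇ ℝ) :
    ‖((1 - steklovCLM hδ) ^ r) F‖ ≤ 2 ^ r * Kr r δ F := by
  rw [← div_le_iff₀' (by positivity)]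
  refine le_csInf ⟨_, 0, contDiff_const, ?_, ?_, rfl⟩ ?_
  · exact ⟨0, by rintro _ ⟨x, rfl⟩; simp⟩
  · exact ⟨0, by rintro _ ⟨x, rfl⟩; simp [Pi.zero_def]⟩
  rintro _ ⟨g, hg, hgb, hgd, rfl⟩
  replace hg : ContDiff ℝ r g := hg
  obtain ⟨G, rfl⟩ := exists_coe_eq hg.continuous hgb
  rw [div_le_iff₀' (by positivity)]
  set M := ⨆ x, |iteratedDeriv r G x| with hM
  have hM0 : 0 ≤ M := Real.iSup_nonneg fun x => abs_nonneg _
  have e : ((1 - steklovCLM hδ) ^ r) F =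
      ((1 - steklovCLM hδ) ^ r) (F - G) + ((1 - steklovCLM hδ) ^ r) G := by
    rw [← map_add, sub_add_cancel]
  have h1 : ‖((1 - steklovCLM hδ) ^ r) (F - G)‖ ≤ 2 ^ r * ⨆ x, |F x - G x| := by
    have := norm_one_sub_pow_apply_le (norm_steklovCLM_le hδ) r (F - G)
    rwa [norm_eq_iSup_abs (F - G)] at this
  have h2 : ‖((1 - steklovCLM hδ) ^ r) G‖ ≤ (δ / 2) ^ r * M := by
    refine (norm_le (by positivity)).2 fun x => ?_
    rw [coe_one_sub_steklovCLM_pow]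
    exact abs_steklovDiff_iterate_le hδ r hg (fun y => le_ciSup hgd y) x
  have h3 : (δ / 2) ^ r * M ≤ 2 ^ r * (δ ^ r * M) := by
    rw [← mul_assoc, ← mul_pow]
    gcongr
    linarith
  rw [e, mul_add]
  exact (norm_add_le _ _).trans (add_le_add h1 (h2.trans h3))

theorem Kr_le_norm {r : ℕ} {δ : ℝ} (hδ : 0 < δ) (F : ℝ →ᵇ ℝ) :
    Kr r δ F ≤ 2 ^ r * ((r : ℝ) ^ r + 10 ^ r) * ‖((1 - steklovCLM hδ) ^ r) F‖ := by
  set T := steklovCLM hδ with hTdef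
  set D := forwardDiffCLM δ
  have hDT : Commute D T := commute_forwardDiffCLM_steklovCLM hδ
  set U := T ^ (2 * r) with hU
  set Q := ∑ i ∈ Finset.range r, (1 - U) ^ i
  have hUn : ‖U‖ ≤ 1 := norm_pow_le_one (norm_steklovCLM_le hδ) _
  have hcomm : ∀ A, Commute A T → Commute A Q := fun A hA =>
    Commute.sum_right _ _ _ fun i _ =>
      (commute_one_sub_right (hA.pow_right _)).pow_right i
  have hUQ : U * Q = 1 - (1 - U) ^ r := by
    have e : 1 - (1 - U) = U := by abel
    simpa only [e] using mul_neg_geom_sum (1 - U) r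
  have hsplit : U * Q = T ^ r * (T ^ r * Q) := by
    rw [hU, two_mul, pow_add, mul_assoc]
  set G := (T ^ r) ((T ^ r * Q) F) with hG
  have hFG : F - G = ((1 - U) ^ r) F := by
    have : G = (U * Q) F := by rw [hsplit]; rfl
    rw [this, hUQ]
    simp
  obtain ⟨hc, hi⟩ := steklovCLM_pow_contDiff_and_iteratedDeriv hδ r ((T ^ r * Q) F)
  set H := (D ^ r) ((T ^ r * Q) F) with hH
  have hHQ : H = Q (((D * T) ^ r) F) := by
    have : D ^ r * (T ^ r * Q) = Q * (D * T) ^ r := by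
      rw [← mul_assoc, ← hDT.mul_pow]
      exact (hcomm _ ((hDT.mul_left (Commute.refl T)).pow_left r)).eq
    rw [hH, ← mul_apply_eq_comp, this]
    rfl
  have habs : ∀ x, |iteratedDeriv r G x| ≤ ‖H‖ / δ ^ r := by
    intro x
    rw [hi x, abs_div, abs_of_pos (pow_pos hδ r)]
    gcongr
    exact H.norm_coe_le_norm x
  have hH10 : ‖H‖ ≤ 2 ^ r * (10 ^ r * ‖((1 - T) ^ r) F‖) := by
    rw [hHQ]
    refine (norm_sum_one_sub_pow_apply_le hUn r _).trans ?_
    gcongr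
    exact norm_forwardDiffCLM_mul_steklovCLM_pow_le hδ r F
  have hFGn : (⨆ x, |F x - G x|) ≤ (2 * r) ^ r * ‖((1 - T) ^ r) F‖ := by
    have h1 := norm_one_sub_pow_pow_apply_le (norm_steklovCLM_le hδ) (2 * r) r F
    rw [← hTdef, ← hU, ← hFG, norm_eq_iSup_abs] at h1
    rw [Nat.cast_mul, Nat.cast_ofNat] at h1
    exact h1
  have hsup : δ ^ r * (⨆ x, |iteratedDeriv r G x|) ≤ ‖H‖ := by
    rw [← le_div_iff₀' (pow_pos hδ r)]
    exact ciSup_le habs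
  refine (Kr_le hδ hc (bddAbove_range_abs G)
    ⟨_, by rintro _ ⟨x, rfl⟩; exact habs x⟩).trans ?_
  rw [mul_pow] at hFGn
  linarith

theorem Kr_equiv (f : ℝ → ℝ) (hf : Continuous f)
    (hb : BddAbove (Set.range fun x => |f x|)) (r : ℕ) (hr : 1 ≤ r) (δ : ℝ) (hδ : 0 < δ) :
    (⨆ x, |(steklovDiff δ)^[r] f x|) ≤ 2 ^ r * Kr r δ f ∧
    Kr r δ f ≤ 2 ^ r * ((r : ℝ) ^ r + 34 ^ r) * ⨆ x, |(steklovDiff δ)^[r] f x| := by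
  obtain ⟨F, rfl⟩ := exists_coe_eq hf hb
  rw [← coe_one_sub_steklovCLM_pow hδ, ← norm_eq_iSup_abs]
  refine ⟨le_Kr hδ F, (Kr_le_norm hδ F).trans ?_⟩
  gcongr
  norm_num
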